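/- arXiv:2101.04967 — 5 statements merged into one kernel-verified Lean document; each statement's English description precedes it below -/
import Mathlib

section
/- Let X be a compact metric space and let {𝒫_i}_{i ∈ I} be any collection of partitions of X, each of which has closed atoms and is upper semicontinuous. Then the common refinement ⋁_{i∈I} 𝒫_i (the partition whose atoms are the nonempty intersections ⋂_{i∈I} A_i with A_i an atom of 𝒫_i) has closed atoms and is upper semicontinuous. -/
open MeasureTheory Filter Topology Metric

section TopDefs

variable {X : Type*} [MetricSpace X]

/-- The Cesàro (Birkhoff) averages `(1/n) ∑_{i<n} f(Tⁱ x)`. -/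
noncomputable def cesaro (T : X → X) (f : X → ℝ) (n : ℕ) (x : X) : ℝ :=
  (n : ℝ)⁻¹ * ∑ i ∈ Finset.range n, f (T^[i] x)

/-- `P` is a partition of `X` (into nonempty sets, every point in exactly one atom). -/
def IsPartition (P : Set (Set X)) : Prop :=
  (∀ A ∈ P, A.Nonempty) ∧ ∀ x : X, ∃! A : Set X, A ∈ P ∧ x ∈ A

/-- A partition is upper semicontinuous if whenever a sequence of atoms converges in the
Hausdorff metric to a (nonempty compact) set `S`, then `S` is contained in some atom. -/
def PartitionUSC (P : Set (Set X)) : Prop :=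
  ∀ A : ℕ → Set X, (∀ n, A n ∈ P) → ∀ S : Set X, S.Nonempty → IsCompact S →
    Tendsto (fun n => hausdorffDist (A n) S) atTop (𝓝 0) → ∃ B ∈ P, S ⊆ B

/-- A partition is lower semicontinuous if whenever a sequence of atoms converges in the
Hausdorff metric to a (nonempty compact) set `S`, then `S` contains some atom. -/
def PartitionLSC (P : Set (Set X)) : Prop :=
  ∀ A : ℕ → Set X, (∀ n, A n ∈ P) → ∀ S : Set X, S.Nonempty → IsCompact S →
    Tendsto (fun n => hausdorffDist (A n) S) atTop (𝓝 0) → ∃ B ∈ P, B ⊆ S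

/-- Upper semicontinuity of a (compact-)set-valued function: if `yₙ → y₀` and
`f(yₙ) → S` in the Hausdorff metric, then `S ⊆ f(y₀)`. -/
def SetValuedUSC {Y : Type*} [MetricSpace Y] (f : Y → Set X) : Prop :=
  ∀ (y : ℕ → Y) (y₀ : Y), Tendsto y atTop (𝓝 y₀) →
    ∀ S : Set X, S.Nonempty → IsCompact S →
      Tendsto (fun n => hausdorffDist (f (y n)) S) atTop (𝓝 0) → S ⊆ f y₀

/-- Lower semicontinuity of a (compact-)set-valued function: if `yₙ → y₀` and
`f(yₙ) → S` in the Hausdorff metric, then `f(y₀) ⊆ S`. -/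
def SetValuedLSC {Y : Type*} [MetricSpace Y] (f : Y → Set X) : Prop :=
  ∀ (y : ℕ → Y) (y₀ : Y), Tendsto y atTop (𝓝 y₀) →
    ∀ S : Set X, S.Nonempty → IsCompact S →
      Tendsto (fun n => hausdorffDist (f (y n)) S) atTop (𝓝 0) → f y₀ ⊆ S

/-- A set is invariant for the homeomorphism `T` if `T(K) = K`. -/
def IsInvariantSet (T : X ≃ₜ X) (K : Set X) : Prop := T '' K = K

/-- A minimal set: nonempty, closed, invariant, with no proper nonempty closed invariant
subset. -/
def IsMinimalSet (T : X ≃ₜ X) (K : Set X) : Prop :=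
  K.Nonempty ∧ IsClosed K ∧ IsInvariantSet T K ∧
    ∀ K' : Set X, K' ⊆ K → K'.Nonempty → IsClosed K' → IsInvariantSet T K' → K' = K

/-- A system is semi-simple if `X` is a union of minimal sets. -/
def SemiSimple (T : X ≃ₜ X) : Prop :=
  ∀ x : X, ∃ K : Set X, IsMinimalSet T K ∧ x ∈ K

/-- A system is uniform if the Cesàro means of every continuous function converge
uniformly on `X`. -/
def UniformSystem (T : X ≃ₜ X) : Prop :=
  ∀ f : C(X, ℝ), ∃ g : X → ℝ,
    TendstoUniformly (fun n x => cesaro (⇑T) (⇑f) n x) g atTop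

/-- Uniformity of the subsystem carried by the set `M`: the Cesàro means of every
continuous function converge uniformly on `M`. -/
def UniformOn (T : X ≃ₜ X) (M : Set X) : Prop :=
  ∀ f : C(X, ℝ), ∃ g : X → ℝ,
    TendstoUniformlyOn (fun n x => cesaro (⇑T) (⇑f) n x) g atTop M

/-- Strictly uniform = uniform + semi-simple. -/
def StrictlyUniform (T : X ≃ₜ X) : Prop := UniformSystem T ∧ SemiSimple T

end TopDefs

section MeasDefs

variable {X : Type*} [MetricSpace X] [CompactSpace X]
  [MeasurableSpace X] [BorelSpace X]

/-- A `T`-invariant Borel probability measure. -/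
def IsInvariantMeasure (T : X ≃ₜ X) (μ : ProbabilityMeasure X) : Prop :=
  μ.toMeasure.map ⇑T = μ.toMeasure

/-- An ergodic `T`-invariant Borel probability measure. -/
def IsErgodicMeasure (T : X ≃ₜ X) (μ : ProbabilityMeasure X) : Prop :=
  Ergodic (⇑T) μ.toMeasure

/-- `x` is generic for `μ`: the Cesàro means of every continuous function at `x`
converge to the integral of the function against `μ`. -/
def IsGenericFor (T : X ≃ₜ X) (x : X) (μ : ProbabilityMeasure X) : Prop :=
  ∀ f : C(X, ℝ),
    Tendsto (fun n => cesaro (⇑T) (⇑f) n x) atTop (𝓝 (∫ y, f y ∂μ.toMeasure))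

/-- Pointwise ergodic: every point is generic for some ergodic measure. -/
def PointwiseErgodic (T : X ≃ₜ X) : Prop :=
  ∀ x : X, ∃ μ : ProbabilityMeasure X, IsErgodicMeasure T μ ∧ IsGenericFor T x μ

/-- The set of points generic for `μ` (a fiber of the map `Φ`). -/
def genericFiber (T : X ≃ₜ X) (μ : ProbabilityMeasure X) : Set X :=
  {x : X | IsGenericFor T x μ}

/-- The generic-point partition `𝒫`: the (nonempty) fibers of the map `Φ` sending each
point to the ergodic measure it generates. -/
def genericPartition (T : X ≃ₜ X) : Set (Set X) :=
  {A : Set X | ∃ μ : ProbabilityMeasure X, IsErgodicMeasure T μ ∧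
    (genericFiber T μ).Nonempty ∧ A = genericFiber T μ}

/-- Continuously pointwise ergodic: every point is generic for an ergodic measure and the
map `Φ` sending each point to that measure is continuous (weak-star topology). -/
def ContinuouslyPointwiseErgodic (T : X ≃ₜ X) : Prop :=
  ∃ Φ : X → ProbabilityMeasure X, Continuous Φ ∧
    ∀ x : X, IsErgodicMeasure T (Φ x) ∧ IsGenericFor T x (Φ x)

/-- Continuously strictly pointwise ergodic = continuously pointwise ergodic +
semi-simple. -/
def ContinuouslyStrictlyPointwiseErgodic (T : X ≃ₜ X) : Prop :=
  ContinuouslyPointwiseErgodic T ∧ SemiSimple T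

/-- The set `K` carries exactly one `T`-invariant Borel probability measure. -/
def UniquelyErgodicOn (T : X ≃ₜ X) (K : Set X) : Prop :=
  ∃! μ : ProbabilityMeasure X, IsInvariantMeasure T μ ∧ μ.toMeasure K = 1

/-- Partitionable: `X` is a disjoint union of closed invariant uniquely ergodic sets. -/
def Partitionable (T : X ≃ₜ X) : Prop :=
  ∃ P : Set (Set X), IsPartition P ∧
    ∀ K ∈ P, IsClosed K ∧ IsInvariantSet T K ∧ UniquelyErgodicOn T K

/-- Strictly partitionable: `X` is a union of strictly ergodic (minimal and uniquely
ergodic) subsystems. -/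
def StrictlyPartitionable (T : X ≃ₜ X) : Prop :=
  ∀ x : X, ∃ K : Set X, x ∈ K ∧ IsMinimalSet T K ∧ UniquelyErgodicOn T K

/-- The topological support of a measure: points all of whose open neighborhoods have
positive measure (equivalently, the smallest closed set of full measure). -/
def msupp (μ : ProbabilityMeasure X) : Set X :=
  {x : X | ∀ U : Set X, IsOpen U → x ∈ U → 0 < μ.toMeasure U}

/-- The set `ℳ_T^e(X)` of ergodic invariant probability measures. -/
def ErgodicSet (T : X ≃ₜ X) : Set (ProbabilityMeasure X) :=
  {μ : ProbabilityMeasure X | IsErgodicMeasure T μ}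

/-- Continuity of the set-valued map `supp : ℳ_T^e(X) → 2^X` (sequentially, via the
Hausdorff metric; `ℳ_T^e(X)` carries the weak-star topology, which is metrizable). -/
def SuppContinuousOnErgodic (T : X ≃ₜ X) : Prop :=
  ∀ μ ∈ ErgodicSet T, ∀ ν : ℕ → ProbabilityMeasure X,
    (∀ n, ν n ∈ ErgodicSet T) → Tendsto ν atTop (𝓝 μ) →
    Tendsto (fun n => hausdorffDist (msupp (ν n)) (msupp μ)) atTop (𝓝 0)

end MeasDefs
/-- the common refinement of any collection of upper semicontinuous
partitions of a compact metric space with closed atoms has closed atoms and is upper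
semicontinuous. -/
theorem stmt_0 {X : Type*} [MetricSpace X] [CompactSpace X]
    {I : Type*} (P : I → Set (Set X))
    (hpart : ∀ i, IsPartition (P i))
    (hclosed : ∀ i, ∀ A ∈ P i, IsClosed A)
    (husc : ∀ i, PartitionUSC (P i))
    (Q : Set (Set X))
    (hQ : Q = {S : Set X | S.Nonempty ∧
      ∃ A : I → Set X, (∀ i, A i ∈ P i) ∧ S = ⋂ i, A i}) :
    (∀ S ∈ Q, IsClosed S) ∧ PartitionUSC Q := by
  classical
  have hne : ∀ {s t : Set X}, s.Nonempty → t.Nonempty → hausdorffEDist s t ≠ ⊤ := by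
    intro s t hs ht
    exact hausdorffEDist_ne_top_of_nonempty_of_bounded hs ht
      (isCompact_univ.isBounded.subset (Set.subset_univ _))
      (isCompact_univ.isBounded.subset (Set.subset_univ _))
  subst hQ
  refine ⟨?_, ?_⟩
  · rintro S ⟨-, A, hA, rfl⟩
    exact isClosed_iInter fun i => hclosed i _ (hA i)
  · intro B hB S hS hSc hlim
    have hBne : ∀ n, (B n).Nonempty := fun n => (hB n).1
    choose A hA hBA using fun n => (hB n).2
    have key : ∀ i, ∃ C ∈ P i, S ⊆ C := by
      intro i
      let K : ℕ → TopologicalSpace.NonemptyCompacts X := fun n =>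
        ⟨⟨A n i, (hclosed i _ (hA n i)).isCompact⟩, (hpart i).1 _ (hA n i)⟩
      obtain ⟨T, φ, hφ, hT⟩ := CompactSpace.tendsto_subseq K
      have hT' : Tendsto (fun n => hausdorffDist (A (φ n) i) (T : Set X)) atTop (𝓝 0) := by
        have := tendsto_iff_dist_tendsto_zero.1 hT
        exact this
      obtain ⟨C, hC, hTC⟩ := husc i (fun n => A (φ n) i) (fun n => hA _ i) T T.nonempty
        T.isCompact hT'
      refine ⟨C, hC, fun s hs => hTC ?_⟩
      have hcl : IsClosed (T : Set X) := T.isCompact.isClosed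
      rw [← hcl.closure_eq, Metric.mem_closure_iff]
      intro ε hε
      have e1 := (hlim.comp hφ.tendsto_atTop).eventually (gt_mem_nhds (half_pos hε))
      have e2 := hT'.eventually (gt_mem_nhds (half_pos hε))
      obtain ⟨n, h1, h2⟩ := (e1.and e2).exists
      obtain ⟨b, hb, hbs⟩ := exists_dist_lt_of_hausdorffDist_lt' hs h1 (hne (hBne _) hS)
      have hbA : b ∈ A (φ n) i := by
        have := hBA (φ n)
        rw [Function.comp_apply] at *
        rw [this] at hb
        exact Set.mem_iInter.1 hb i
      obtain ⟨t, ht, hbt⟩ := exists_dist_lt_of_hausdorffDist_lt hbA h2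
        (hne ⟨b, hbA⟩ T.nonempty)
      refine ⟨t, ht, ?_⟩
      have := dist_triangle_left s t b
      linarith
    choose C hC hSC using key
    have hsub : S ⊆ ⋂ i, C i := Set.subset_iInter hSC
    exact ⟨⋂ i, C i, ⟨hS.mono hsub, C, hC, rfl⟩, hsub⟩
end

section
/- A topological dynamical system (X,T) is partitionable if and only if it is pointwise ergodic and the generic-point partition 𝒫 has closed atoms. -/
open MeasureTheory Filter Topology Metric

section Helpers

variable {X : Type*} [MetricSpace X] [CompactSpace X]
  [MeasurableSpace X] [BorelSpace X]

theorem hp_bound (f : C(X, ℝ)) : ∃ C : ℝ, 0 ≤ C ∧ ∀ x, |f x| ≤ C :=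
  ⟨‖f‖, norm_nonneg _, fun x => by simpa using f.norm_coe_le_norm x⟩

theorem hp_cesaro_bound (T : X → X) (f : X → ℝ) (C : ℝ) (hC : 0 ≤ C) (h : ∀ x, |f x| ≤ C)
    (n : ℕ) (x : X) : |cesaro T f n x| ≤ C := by
  unfold cesaro
  rcases Nat.eq_zero_or_pos n with rfl | hn
  · simpa using hC
  have hn' : (0 : ℝ) < n := by exact_mod_cast hn
  rw [abs_mul, abs_of_pos (inv_pos.2 hn')]
  have : |∑ i ∈ Finset.range n, f (T^[i] x)| ≤ n * C := by
    refine (Finset.abs_sum_le_sum_abs _ _).trans ?_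
    refine (Finset.sum_le_sum (fun i _ => h _)).trans ?_
    simp
  calc (n : ℝ)⁻¹ * _ ≤ (n : ℝ)⁻¹ * (n * C) := by gcongr
    _ = C := by field_simp

theorem hp_cesaro_diff (T : X → X) (f : C(X, ℝ)) (x : X) :
    Tendsto (fun n => cesaro T f n (T x) - cesaro T f n x) atTop (𝓝 0) := by
  obtain ⟨C, hC, h⟩ := hp_bound f
  have key : ∀ n : ℕ, cesaro T f n (T x) - cesaro T f n x
      = (n : ℝ)⁻¹ * (f (T^[n] x) - f x) := by
    intro n
    unfold cesaro
    rw [← mul_sub, ← Finset.sum_sub_distrib]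
    congr 1
    have := Finset.sum_range_sub (fun i => f (T^[i] x)) n
    simp only [Function.iterate_succ_apply, Function.iterate_zero, id] at this
    exact this
  refine squeeze_zero_norm (a := fun n : ℕ => (n : ℝ)⁻¹ * (2 * C)) ?_ ?_
  · intro n
    rw [key, Real.norm_eq_abs, abs_mul, abs_of_nonneg (inv_nonneg.2 (Nat.cast_nonneg n))]
    have h1 := abs_le.1 (h (T^[n] x))
    have h2 := abs_le.1 (h x)
    gcongr
    exact abs_le.2 ⟨by linarith, by linarith⟩
  · simpa using (tendsto_inv_atTop_nhds_zero_nat (𝕜 := ℝ)).mul_const (2 * C)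

theorem hp_ext (μ ν : ProbabilityMeasure X)
    (h : ∀ f : C(X, ℝ), ∫ y, f y ∂μ.toMeasure = ∫ y, f y ∂ν.toMeasure) : μ = ν := by
  apply Subtype.ext
  have i1 : IsFiniteMeasure (μ : Measure X) := inferInstance
  have i2 : IsFiniteMeasure (ν : Measure X) := inferInstance
  exact @ext_of_forall_integral_eq_of_IsFiniteMeasure X _ _ _ _ _ _ i1 i2
    (fun f => h f.toContinuousMap)

theorem hp_generic_unique (T : X ≃ₜ X) {x : X} {μ ν : ProbabilityMeasure X}
    (h1 : IsGenericFor T x μ) (h2 : IsGenericFor T x ν) : μ = ν :=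
  hp_ext _ _ fun f => tendsto_nhds_unique (h1 f) (h2 f)

/-- If averages of continuous functions converge along `l` to the integral and the orbit is in a
closed set, the closed set has full measure. -/
theorem hp_full (T : X ≃ₜ X) {K : Set X} (hK : IsClosed K) (hT : IsInvariantSet T K) {x : X}
    (hx : x ∈ K) (μ : ProbabilityMeasure X) (l : Filter ℕ) [l.NeBot]
    (h : ∀ f : C(X, ℝ), Tendsto (fun n => cesaro (⇑T) (⇑f) n x) l (𝓝 (∫ y, f y ∂μ.toMeasure))) :
    μ.toMeasure K = 1 := by
  have horb : ∀ i : ℕ, T^[i] x ∈ K := by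
    intro i
    induction i with
    | zero => exact hx
    | succ i ih =>
      rw [Function.iterate_succ_apply', ← hT]
      exact ⟨_, ih, rfl⟩
  let f : C(X, ℝ) := ⟨fun y => infDist y K, continuous_infDist_pt K⟩
  have h0 : ∀ n, cesaro T f n x = 0 := by
    intro n
    unfold cesaro
    rw [Finset.sum_eq_zero, mul_zero]
    intro i _
    exact infDist_zero_of_mem (horb i)
  have h1 : ∫ y, f y ∂μ.toMeasure = 0 := by
    refine tendsto_nhds_unique (h f) ?_
    simp only [h0]
    exact tendsto_const_nhds
  have hint : Integrable (fun y => f y) μ.toMeasure :=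
    f.continuous.integrable_of_hasCompactSupport (HasCompactSupport.of_compactSpace f)
  replace h1 := (integral_eq_zero_iff_of_nonneg (μ := μ.toMeasure) (f := fun y => f y)
    (fun y => infDist_nonneg) hint).1 h1
  rw [← prob_compl_eq_zero_iff hK.measurableSet]
  refine measure_mono_null ?_ h1
  intro y hy hy'
  exact hy ((hK.mem_iff_infDist_zero ⟨x, hx⟩).2 hy')

/-- Limits along ultrafilters are given by invariant measures. -/
theorem hp_limit (T : X ≃ₜ X) (x : X) (U : Ultrafilter ℕ) (hU : (U : Filter ℕ) ≤ atTop) :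
    ∃ ν : ProbabilityMeasure X, IsInvariantMeasure T ν ∧
      ∀ f : C(X, ℝ), Tendsto (fun n => cesaro (⇑T) (⇑f) n x) U (𝓝 (∫ y, f y ∂ν.toMeasure)) := by
  have hlim : ∀ f : C(X, ℝ), ∃ a : ℝ, Tendsto (fun n => cesaro (⇑T) (⇑f) n x) U (𝓝 a) := by
    intro f
    obtain ⟨C, hC, h⟩ := hp_bound f
    obtain ⟨a, -, ha⟩ := isCompact_iff_ultrafilter_le_nhds.1 (isCompact_Icc (a := -C) (b := C))
      (U.map (fun n => cesaro (⇑T) (⇑f) n x)) (by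
        rw [Filter.le_principal_iff, Ultrafilter.coe_map]
        exact Filter.mem_map.2 (Filter.Eventually.of_forall
          fun n => abs_le.1 (hp_cesaro_bound T f C hC h n x)))
    exact ⟨a, ha⟩
  choose L hL using hlim
  let L' : CompactlySupportedContinuousMap X ℝ →ₗ[ℝ] ℝ :=
    { toFun := fun f => L f.toContinuousMap
      map_add' := by
        intro f g
        refine tendsto_nhds_unique (hL _) ?_
        refine ((hL f.toContinuousMap).add (hL g.toContinuousMap)).congr ?_
        intro n
        simp [cesaro, Finset.sum_add_distrib, mul_add]
      map_smul' := by
        intro c f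
        refine tendsto_nhds_unique (hL _) ?_
        refine ((hL f.toContinuousMap).const_mul c).congr ?_
        intro n
        simp only [cesaro, Finset.mul_sum]
        refine Finset.sum_congr rfl fun i _ => ?_
        simp
        ring }
  let Λ : PositiveLinearMap ℝ (CompactlySupportedContinuousMap X ℝ) ℝ :=
    PositiveLinearMap.mk₀ L' (by
      intro f hf
      refine ge_of_tendsto' (hL f.toContinuousMap) ?_
      intro n
      unfold cesaro
      exact mul_nonneg (by positivity) (Finset.sum_nonneg fun i _ => hf _))
  have hint : ∀ f : C(X, ℝ), ∫ y, f y ∂(RealRMK.rieszMeasure Λ) = L f := by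
    intro f
    exact RealRMK.integral_rieszMeasure Λ (CompactlySupportedContinuousMap.continuousMapEquiv f)
  have h1 : L 1 = 1 := by
    refine tendsto_nhds_unique (hL 1) ?_
    refine tendsto_const_nhds.congr' ?_
    filter_upwards [hU (eventually_gt_atTop 0)] with n hn
    have : (n : ℝ) ≠ 0 := by exact_mod_cast hn.ne'
    simp [cesaro, this]
  have hprob : IsProbabilityMeasure (RealRMK.rieszMeasure Λ) := by
    constructor
    have := hint 1
    rw [h1] at this
    simp at this
    simpa [Measure.real, ENNReal.toReal_eq_one_iff] using this
  refine ⟨⟨RealRMK.rieszMeasure Λ, hprob⟩, ?_, fun f => by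
    change Tendsto _ _ (𝓝 (∫ y, f y ∂(RealRMK.rieszMeasure Λ)))
    rw [hint]; exact hL f⟩
  change (RealRMK.rieszMeasure Λ).map T = RealRMK.rieszMeasure Λ
  have : IsProbabilityMeasure ((RealRMK.rieszMeasure Λ).map T) :=
    Measure.isProbabilityMeasure_map T.continuous.measurable.aemeasurable
  refine ext_of_forall_integral_eq_of_IsFiniteMeasure (fun f => ?_)
  rw [integral_map T.continuous.measurable.aemeasurable
    f.continuous.measurable.aestronglyMeasurable]
  have e1 := hint (f.toContinuousMap.comp ⟨T, T.continuous⟩)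
  have e2 := hint f.toContinuousMap
  refine e1.trans (Eq.trans ?_ e2.symm)
  rw [← sub_eq_zero]
  refine tendsto_nhds_unique ((hL _).sub (hL _)) ?_
  refine ((hp_cesaro_diff T f.toContinuousMap x).mono_left hU).congr ?_
  intro n
  simp only [cesaro]
  congr 2
  refine Finset.sum_congr rfl fun i _ => ?_
  simp only [ContinuousMap.comp_apply, ContinuousMap.coe_mk]
  rw [← Function.iterate_succ_apply, Function.iterate_succ_apply']

theorem hp_generic_of_ue (T : X ≃ₜ X) {K : Set X} (hK : IsClosed K) (hT : IsInvariantSet T K)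
    {μ : ProbabilityMeasure X}
    (hu : ∀ ν : ProbabilityMeasure X, IsInvariantMeasure T ν ∧ ν.toMeasure K = 1 → ν = μ)
    {x : X} (hx : x ∈ K) : IsGenericFor T x μ := by
  intro f
  rw [tendsto_iff_ultrafilter]
  intro U hU
  obtain ⟨ν, hν, h⟩ := hp_limit T x U hU
  have := hu ν ⟨hν, hp_full T hK hT hx ν U h⟩
  rw [← this]
  exact h f

theorem hp_ergodic_of_ue (T : X ≃ₜ X) {K : Set X} (hK : IsClosed K)
    {μ : ProbabilityMeasure X} (hμ : IsInvariantMeasure T μ) (hμK : μ.toMeasure K = 1)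
    (hu : ∀ ν : ProbabilityMeasure X, IsInvariantMeasure T ν ∧ ν.toMeasure K = 1 → ν = μ) :
    IsErgodicMeasure T μ := by
  have hTm : Measurable T := T.continuous.measurable
  refine ⟨⟨hTm, hμ⟩, ⟨fun s hs hTs => ?_⟩⟩
  rw [eventuallyConst_set']
  by_cases h0 : μ.toMeasure s = 0
  · left
    exact ae_eq_empty.2 h0
  right
  have hp : IsProbabilityMeasure (ProbabilityTheory.cond μ.toMeasure s) :=
    ProbabilityTheory.cond_isProbabilityMeasure h0
  have hinv : IsInvariantMeasure T ⟨ProbabilityTheory.cond μ.toMeasure s, hp⟩ := by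
    change (ProbabilityTheory.cond μ.toMeasure s).map T = ProbabilityTheory.cond μ.toMeasure s
    ext A hA
    rw [Measure.map_apply hTm hA, ProbabilityTheory.cond_apply hs, ProbabilityTheory.cond_apply hs]
    congr 1
    conv_lhs => rw [← hTs]
    rw [← Set.preimage_inter, ← Measure.map_apply hTm (hs.inter hA)]
    exact congrArg (fun m => m (s ∩ A)) hμ
  have hK1 : (ProbabilityTheory.cond μ.toMeasure s) K = 1 := by
    have hae : ∀ᵐ y ∂μ.toMeasure, y ∈ K :=
      (mem_ae_iff_prob_eq_one hK.measurableSet).2 hμK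
    refine (mem_ae_iff_prob_eq_one hK.measurableSet).1 ?_
    exact ProbabilityTheory.cond_absolutelyContinuous.ae_le hae
  have he := hu ⟨_, hp⟩ ⟨hinv, hK1⟩
  have he' : ProbabilityTheory.cond μ.toMeasure s = μ.toMeasure := congrArg Subtype.val he
  have : μ.toMeasure s = 1 := by
    conv_lhs => rw [← he']
    exact ProbabilityTheory.cond_apply_self h0 (measure_ne_top _ _)
  exact ae_eq_univ.2 ((prob_compl_eq_zero_iff hs).2 this)

theorem hp_generic_apply (T : X ≃ₜ X) {x : X} {μ : ProbabilityMeasure X} :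
    IsGenericFor T (T x) μ ↔ IsGenericFor T x μ := by
  constructor
  · intro h f
    simpa using (h f).sub (hp_cesaro_diff T f x)
  · intro h f
    simpa using (h f).add (hp_cesaro_diff T f x)

theorem hp_fiber_inv (T : X ≃ₜ X) (μ : ProbabilityMeasure X) :
    IsInvariantSet T (genericFiber T μ) := by
  ext y
  constructor
  · rintro ⟨x, hx, rfl⟩
    exact (hp_generic_apply T).2 hx
  · intro hy
    refine ⟨T.symm y, ?_, by simp⟩
    refine (hp_generic_apply T).1 ?_
    rw [T.apply_symm_apply]
    exact hy

theorem hp_integral_cesaro (T : X ≃ₜ X) {ν : ProbabilityMeasure X} (hν : IsInvariantMeasure T ν)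
    (f : C(X, ℝ)) {n : ℕ} (hn : 0 < n) :
    ∫ y, cesaro T f n y ∂ν.toMeasure = ∫ y, f y ∂ν.toMeasure := by
  have hmp : MeasurePreserving T ν.toMeasure ν.toMeasure := ⟨T.continuous.measurable, hν⟩
  have hint : ∀ g : C(X, ℝ), Integrable (fun y => g y) ν.toMeasure := fun g =>
    g.continuous.integrable_of_hasCompactSupport (HasCompactSupport.of_compactSpace g)
  unfold cesaro
  rw [integral_const_mul, integral_finsetSum]
  · have : ∀ i ∈ Finset.range n, ∫ y, f (T^[i] y) ∂ν.toMeasure = ∫ y, f y ∂ν.toMeasure := by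
      intro i _
      have h := hmp.iterate i
      conv_rhs => rw [← h.map_eq]
      rw [integral_map h.measurable.aemeasurable f.continuous.measurable.aestronglyMeasurable]
    rw [Finset.sum_congr rfl this]
    have : (n : ℝ) ≠ 0 := by exact_mod_cast hn.ne'
    simp [this]
  · intro i _
    exact hint (f.comp ⟨T^[i], T.continuous.iterate i⟩)

theorem hp_fiber_ue (T : X ≃ₜ X) {μ : ProbabilityMeasure X} (hμ : IsErgodicMeasure T μ)
    (hne : (genericFiber T μ).Nonempty) (hc : IsClosed (genericFiber T μ)) :
    UniquelyErgodicOn T (genericFiber T μ) := by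
  obtain ⟨x, hx⟩ := hne
  refine ⟨μ, ⟨hμ.map_eq, hp_full T hc (hp_fiber_inv T μ) hx μ atTop hx⟩, ?_⟩
  rintro ν ⟨hν, hν1⟩
  refine hp_ext _ _ fun f => ?_
  obtain ⟨C, hC, h⟩ := hp_bound f
  have hae : ∀ᵐ y ∂ν.toMeasure, y ∈ genericFiber T μ :=
    (mem_ae_iff_prob_eq_one hc.measurableSet).2 hν1
  have key : Tendsto (fun n => ∫ y, cesaro T f n y ∂ν.toMeasure) atTop
      (𝓝 (∫ _, (∫ z, f z ∂μ.toMeasure) ∂ν.toMeasure)) := by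
    refine tendsto_integral_of_dominated_convergence (fun _ => C) ?_ (integrable_const _) ?_ ?_
    · intro n
      have : Continuous (fun y => cesaro T f n y) := by
        unfold cesaro
        exact continuous_const.mul (continuous_finsetSum _ fun i _ =>
          f.continuous.comp (T.continuous.iterate i))
      exact this.measurable.aestronglyMeasurable
    · intro n
      exact Eventually.of_forall fun y => hp_cesaro_bound T f C hC h n y
    · filter_upwards [hae] with y hy using hy f
  have key2 : Tendsto (fun n => ∫ y, cesaro T f n y ∂ν.toMeasure) atTop
      (𝓝 (∫ y, f y ∂ν.toMeasure)) := by
    refine tendsto_const_nhds.congr' ?_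
    filter_upwards [eventually_gt_atTop 0] with n hn
    exact (hp_integral_cesaro T hν f hn).symm
  have := tendsto_nhds_unique key2 key
  simpa using this

end Helpers

/-- `(X,T)` is partitionable iff it is pointwise ergodic and the
generic-point partition `𝒫` has closed atoms. -/
theorem stmt_3 {X : Type*} [MetricSpace X] [CompactSpace X]
    [MeasurableSpace X] [BorelSpace X] (T : X ≃ₜ X) :
    Partitionable T ↔
      PointwiseErgodic T ∧ ∀ A ∈ genericPartition T, IsClosed A := by
  constructor
  · rintro ⟨P, ⟨-, hP⟩, hPK⟩
    have hmem : ∀ x : X, ∃ K ∈ P, x ∈ K ∧ ∃ μ : ProbabilityMeasure X, IsErgodicMeasure T μ ∧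
        μ.toMeasure K = 1 ∧ ∀ y ∈ K, IsGenericFor T y μ := by
      intro x
      obtain ⟨K, ⟨hK, hx⟩, -⟩ := hP x
      obtain ⟨hc, hi, μ, ⟨hμ, hμK⟩, hu⟩ := hPK K hK
      exact ⟨K, hK, hx, μ, hp_ergodic_of_ue T hc hμ hμK hu, hμK,
        fun y hy => hp_generic_of_ue T hc hi hu hy⟩
    refine ⟨fun x => ?_, ?_⟩
    · obtain ⟨K, hK, hx, μ, hμ, -, hg⟩ := hmem x
      exact ⟨μ, hμ, hg x hx⟩
    · rintro A ⟨μ, hμ, ⟨x, hx⟩, rfl⟩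
      obtain ⟨K, hK, hxK, μ', hμ', h1, hg⟩ := hmem x
      obtain rfl := hp_generic_unique T hx (hg x hxK)
      have : genericFiber T μ = K := by
        apply Set.Subset.antisymm
        · intro y hy
          obtain ⟨K', hK', hyK', μ'', hμ'', h1', hg'⟩ := hmem y
          obtain rfl := hp_generic_unique T hy (hg' y hyK')
          have a1 : ∀ᵐ z ∂μ.toMeasure, z ∈ K :=
            (mem_ae_iff_prob_eq_one (hPK K hK).1.measurableSet).2 h1
          have a2 : ∀ᵐ z ∂μ.toMeasure, z ∈ K' :=
            (mem_ae_iff_prob_eq_one (hPK K' hK').1.measurableSet).2 h1'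
          obtain ⟨z, hz, hz'⟩ := (a1.and a2).exists
          rw [(hP z).unique ⟨hK, hz⟩ ⟨hK', hz'⟩]
          exact hyK'
        · exact hg
      rw [this]
      exact (hPK K hK).1
  · rintro ⟨hpe, hcl⟩
    refine ⟨genericPartition T, ⟨?_, ?_⟩, ?_⟩
    · rintro A ⟨μ, hμ, hne, rfl⟩
      exact hne
    · intro x
      obtain ⟨μ, hμ, hg⟩ := hpe x
      refine ⟨genericFiber T μ, ⟨⟨μ, hμ, ⟨x, hg⟩, rfl⟩, hg⟩, ?_⟩
      rintro B ⟨⟨ν, hν, -, rfl⟩, hx⟩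
      rw [hp_generic_unique T hx hg]
    · rintro A hA
      have hc := hcl A hA
      obtain ⟨μ, hμ, hne, rfl⟩ := hA
      exact ⟨hc, hp_fiber_inv T μ, hp_fiber_ue T hμ hne hc⟩
end

section
/- A topological dynamical system (X,T) is strictly partitionable if and only if it is pointwise ergodic and semi-simple. -/
open MeasureTheory Filter Topology Metric

theorem aux_cesaro_eq {X : Type*} [MetricSpace X] (T : X → X) (f : X → ℝ) (n : ℕ) (x : X) :
    cesaro T f n x = birkhoffAverage ℝ T f n x := by
  simp [cesaro, birkhoffAverage, birkhoffSum]

theorem aux_cesaro_apply_sub {X : Type*} [MetricSpace X] [CompactSpace X] (T : X ≃ₜ X)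
    (f : C(X, ℝ)) (x : X) :
    Tendsto (fun n => cesaro T f n (T x) - cesaro T f n x) atTop (𝓝 0) := by
  simp only [aux_cesaro_eq]
  apply tendsto_birkhoffAverage_apply_sub_birkhoffAverage' ℝ
  exact (isCompact_range f.continuous).isBounded

theorem aux_cesaro_comp {X : Type*} [MetricSpace X] (T : X ≃ₜ X) (f : X → ℝ) (n : ℕ) (x : X) :
    cesaro T (f ∘ T) n x = cesaro T f n (T x) := by
  simp only [cesaro, Function.comp]
  congr 1
  refine Finset.sum_congr rfl fun i _ => ?_
  rw [← Function.iterate_succ_apply' (⇑T), Function.iterate_succ_apply]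

theorem aux_iter_mem {X : Type*} [MetricSpace X] (T : X ≃ₜ X) {K : Set X}
    (hK : IsInvariantSet T K) {x : X} (hx : x ∈ K) (n : ℕ) : (⇑T)^[n] x ∈ K := by
  induction n with
  | zero => simpa
  | succ n ih =>
    rw [Function.iterate_succ_apply', ← hK]
    exact ⟨_, ih, rfl⟩

theorem aux_ext {X : Type*} [MetricSpace X] [CompactSpace X]
    [MeasurableSpace X] [BorelSpace X] (μ ν : Measure X) [IsFiniteMeasure μ] [IsFiniteMeasure ν]
    (h : ∀ f : C(X, ℝ), ∫ y, f y ∂μ = ∫ y, f y ∂ν) : μ = ν :=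
  ext_of_forall_integral_eq_of_IsFiniteMeasure fun f => h f.toContinuousMap

theorem aux_integrable {X : Type*} [MetricSpace X] [CompactSpace X]
    [MeasurableSpace X] [BorelSpace X] (μ : Measure X) [IsFiniteMeasure μ] (f : C(X, ℝ)) :
    Integrable (fun y => f y) μ :=
  f.continuous.integrable_of_hasCompactSupport (HasCompactSupport.of_compactSpace _)

theorem aux_inv {X : Type*} [MetricSpace X] [CompactSpace X]
    [MeasurableSpace X] [BorelSpace X] (T : X ≃ₜ X) (x : X) (ν : ProbabilityMeasure X)
    (L : Filter ℕ) [L.NeBot] (hL : L ≤ atTop)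
    (h : ∀ f : C(X, ℝ), Tendsto (fun n => cesaro T f n x) L (𝓝 (∫ y, f y ∂ν.toMeasure))) :
    IsInvariantMeasure T ν := by
  have : IsProbabilityMeasure (ν.toMeasure.map T) :=
    Measure.isProbabilityMeasure_map T.continuous.aemeasurable
  refine aux_ext _ _ fun f => ?_
  rw [integral_map T.continuous.aemeasurable f.continuous.aestronglyMeasurable]
  have h1 := h (f.comp (⟨T, T.continuous⟩ : C(X, X)))
  have h2 := (h f).add ((aux_cesaro_apply_sub T f x).mono_left hL)
  refine tendsto_nhds_unique h1 ?_
  rw [add_zero] at h2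
  refine h2.congr fun n => ?_
  have := aux_cesaro_comp T f n x
  simp only [ContinuousMap.coe_comp, ContinuousMap.coe_mk]
  rw [this]; ring

theorem aux_supp {X : Type*} [MetricSpace X] [CompactSpace X]
    [MeasurableSpace X] [BorelSpace X] (T : X ≃ₜ X) (x : X) (ν : ProbabilityMeasure X)
    (L : Filter ℕ) [L.NeBot]
    (h : ∀ f : C(X, ℝ), Tendsto (fun n => cesaro T f n x) L (𝓝 (∫ y, f y ∂ν.toMeasure)))
    {K : Set X} (hKc : IsClosed K) (hK : IsInvariantSet T K) (hx : x ∈ K) :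
    ν.toMeasure K = 1 := by
  have h1 := h ⟨fun y => infDist y K, continuous_infDist_pt K⟩
  have h2 : ∫ y, infDist y K ∂ν.toMeasure = 0 := by
    refine tendsto_nhds_unique h1 ?_
    refine tendsto_const_nhds.congr fun n => ?_
    simp [cesaro, infDist_zero_of_mem (aux_iter_mem T hK hx _)]
  rw [integral_eq_zero_iff_of_nonneg (fun y => infDist_nonneg)
    (aux_integrable ν.toMeasure ⟨fun y => infDist y K, continuous_infDist_pt K⟩)] at h2
  rw [prob_compl_eq_zero_iff hKc.measurableSet |>.symm]
  have : ∀ᵐ y ∂ν.toMeasure, y ∈ K := by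
    filter_upwards [h2] with y hy
    exact (hKc.mem_iff_infDist_zero ⟨x, hx⟩).2 hy
  exact this

theorem aux_emp {X : Type*} [MetricSpace X] [CompactSpace X]
    [MeasurableSpace X] [BorelSpace X] (T : X ≃ₜ X) (x : X) (n : ℕ) :
    ∃ ν : ProbabilityMeasure X, n ≠ 0 → ∀ f : C(X, ℝ),
      ∫ y, f y ∂ν.toMeasure = cesaro T f n x := by
  by_cases hn : n = 0
  · exact ⟨⟨Measure.dirac x, inferInstance⟩, fun h => absurd hn h⟩
  let m : Measure X := (n : ENNReal)⁻¹ • ∑ i ∈ Finset.range n, Measure.dirac ((⇑T)^[i] x)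
  have hm : IsProbabilityMeasure m := by
    constructor
    simp only [m, Measure.smul_apply, Measure.finsetSum_apply, measure_univ, smul_eq_mul]
    simp
    exact ENNReal.inv_mul_cancel (by simpa using hn) (by simp)
  refine ⟨⟨m, hm⟩, fun _ f => ?_⟩
  change ∫ y, f y ∂m = _
  simp only [m]
  rw [integral_smul_measure, integral_finsetSum_measure]
  · simp [cesaro]
  · intro i _
    exact aux_integrable _ f

theorem aux_generic {X : Type*} [MetricSpace X] [CompactSpace X]
    [MeasurableSpace X] [BorelSpace X] (T : X ≃ₜ X) (x : X) (μ : ProbabilityMeasure X)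
    {K : Set X} (hKc : IsClosed K) (hK : IsInvariantSet T K) (hx : x ∈ K)
    (hu : ∀ ν : ProbabilityMeasure X, IsInvariantMeasure T ν ∧ ν.toMeasure K = 1 → ν = μ) :
    IsGenericFor T x μ := by
  choose E hE using aux_emp T x
  have key : ∀ U : Ultrafilter ℕ, (U : Filter ℕ) ≤ atTop → ∀ ν : ProbabilityMeasure X,
      Tendsto E U (𝓝 ν) → ∀ f : C(X, ℝ),
        Tendsto (fun n => cesaro T f n x) U (𝓝 (∫ y, f y ∂ν.toMeasure)) := by
    intro U hU ν hν f
    have h1 := ProbabilityMeasure.tendsto_iff_forall_integral_tendsto.1 hν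
      (BoundedContinuousFunction.mkOfCompact f)
    refine h1.congr' ?_
    filter_upwards [hU (eventually_ne_atTop 0)] with n hn
    exact hE n hn f
  intro f
  rw [tendsto_iff_ultrafilter]
  intro U hU
  obtain ⟨ν, -, hν⟩ := isCompact_univ.ultrafilter_le_nhds (U.map E) (by simp)
  have hk := key U hU ν hν
  have : ν = μ := hu ν ⟨aux_inv T x ν U hU hk, aux_supp T x ν U hk hKc hK hx⟩
  subst this
  exact hk f

theorem aux_ergodic {X : Type*} [MetricSpace X] [CompactSpace X]
    [MeasurableSpace X] [BorelSpace X] (T : X ≃ₜ X) (μ : ProbabilityMeasure X)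
    {K : Set X} (hi : IsInvariantMeasure T μ) (hμK : μ.toMeasure K = 1) (hKc : IsClosed K)
    (hu : ∀ ν : ProbabilityMeasure X, IsInvariantMeasure T ν ∧ ν.toMeasure K = 1 → ν = μ) :
    IsErgodicMeasure T μ := by
  have hmp : MeasurePreserving T μ.toMeasure μ.toMeasure := ⟨T.continuous.measurable, hi⟩
  refine ⟨hmp, ⟨fun s hs hTs => ?_⟩⟩
  rw [eventuallyConst_set']
  by_cases h0 : μ.toMeasure s = 0
  · left; exact ae_eq_empty.2 h0
  right
  have hp := ProbabilityTheory.cond_isProbabilityMeasure (μ := μ.toMeasure) h0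
  have hν := hu ⟨ProbabilityTheory.cond μ.toMeasure s, hp⟩ ⟨?_, ?_⟩
  · have h1 : ProbabilityTheory.cond μ.toMeasure s = μ.toMeasure := congrArg Subtype.val hν
    rw [ae_eq_univ, ← h1, ProbabilityTheory.cond_apply hs]
    simp
  · have : MeasurePreserving T (ProbabilityTheory.cond μ.toMeasure s)
        (ProbabilityTheory.cond μ.toMeasure s) := by
      refine .smul_measure ?_ _
      have := hmp.restrict_preimage hs
      rwa [hTs] at this
    exact this.map_eq
  · change ProbabilityTheory.cond μ.toMeasure s K = 1
    rw [← prob_compl_eq_zero_iff hKc.measurableSet] at hμK ⊢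
    exact ProbabilityTheory.cond_absolutelyContinuous hμK

theorem aux_cont {X : Type*} [MetricSpace X] (T : X ≃ₜ X) (f : C(X, ℝ)) (n : ℕ) :
    Continuous (fun x => cesaro T f n x) := by
  unfold cesaro
  refine continuous_const.mul (continuous_finsetSum _ fun i _ => ?_)
  exact f.continuous.comp (T.continuous.iterate i)

/-- Pointwise limits of Cesàro means are constant on minimal sets. -/
theorem aux_const {X : Type*} [MetricSpace X] [CompactSpace X] (T : X ≃ₜ X) {K : Set X}
    (hK : IsMinimalSet T K) (f : C(X, ℝ)) (g : X → ℝ)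
    (hg : ∀ y, Tendsto (fun n => cesaro T f n y) atTop (𝓝 (g y)))
    {a b : X} (ha : a ∈ K) (hb : b ∈ K) : g a = g b := by
  obtain ⟨hne, hc, hinv, hmin⟩ := hK
  have hgT : ∀ y, g (T y) = g y := by
    intro y
    have := (hg y).add (aux_cesaro_apply_sub T f y)
    refine tendsto_nhds_unique (hg (T y)) ?_
    simpa using this
  have hdense : ∀ c ∈ K, closure {y | y ∈ K ∧ g y = g c} = K := by
    intro c hcK
    refine hmin _ (closure_minimal (fun y hy => hy.1) hc) ⟨c, subset_closure ⟨hcK, rfl⟩⟩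
      isClosed_closure ?_
    unfold IsInvariantSet
    rw [T.image_closure]
    congr 1
    ext y
    constructor
    · rintro ⟨z, ⟨hz, hz'⟩, rfl⟩
      exact ⟨hinv ▸ ⟨z, hz, rfl⟩, by rw [hgT, hz']⟩
    · rintro ⟨hy, hy'⟩
      rw [← hinv] at hy
      obtain ⟨z, hz, rfl⟩ := hy
      exact ⟨z, ⟨hz, by rw [← hgT, hy']⟩, rfl⟩
  refine eq_of_forall_dist_le fun ε hε => ?_
  have : CompactSpace K := isCompact_iff_compactSpace.1 hc.isCompact
  have : Nonempty K := hne.to_subtype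
  let F : ℕ → Set K := fun N => {y | ∀ m ≥ N, |cesaro T f m y - cesaro T f N y| ≤ ε / 4}
  have hF : ∀ N, IsClosed (F N) := by
    intro N
    simp only [F, Set.ofPred_forall]
    refine isClosed_iInter fun m => isClosed_iInter fun _ => isClosed_le ?_ continuous_const
    exact (((aux_cont T f m).comp continuous_subtype_val).sub
      ((aux_cont T f N).comp continuous_subtype_val)).abs
  have hU : ⋃ N, F N = Set.univ := by
    refine Set.eq_univ_of_forall fun y => ?_
    obtain ⟨N, hN⟩ := Metric.cauchySeq_iff'.1 (hg y).cauchySeq (ε / 4) (by positivity)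
    exact Set.mem_iUnion.2 ⟨N, fun m hm => (hN m hm).le⟩
  obtain ⟨N, y0, hy0⟩ := nonempty_interior_of_iUnion_of_closed hF hU
  have hclose : ∀ y ∈ F N, |g y - cesaro T f N y| ≤ ε / 4 := by
    intro y hy
    refine le_of_tendsto (((hg y).sub_const _).abs) ?_
    filter_upwards [eventually_ge_atTop N] with m hm using hy m hm
  let V : Set X := {y | |cesaro T f N y - cesaro T f N y0| < ε / 4}
  have hV : IsOpen V :=
    isOpen_lt ((aux_cont T f N).sub continuous_const).abs continuous_const
  obtain ⟨W, hW, hWF⟩ := isOpen_induced_iff.1 (isOpen_interior (s := F N))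
  have hy0W : (y0 : X) ∈ W ∩ V := by
    refine ⟨?_, by simp [V]; positivity⟩
    rw [← hWF] at hy0; exact hy0
  have hget : ∀ c ∈ K, |g c - cesaro T f N y0| ≤ ε / 2 := by
    intro c hcK
    have : (y0 : X) ∈ closure {y | y ∈ K ∧ g y = g c} := by rw [hdense c hcK]; exact y0.2
    obtain ⟨z, ⟨hzW, hzV⟩, hzK, hz⟩ := mem_closure_iff.1 this _ (hW.inter hV) hy0W
    have hzF : (⟨z, hzK⟩ : K) ∈ F N := interior_subset (by rw [← hWF]; exact hzW)
    have h1 := hclose _ hzF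
    have h2 : |cesaro T f N z - cesaro T f N y0| < ε / 4 := hzV
    rw [← hz]
    have := abs_sub_le (g z) (cesaro T f N z) (cesaro T f N y0)
    simp only at h1
    linarith
  rw [Real.dist_eq]
  have h1 := hget a ha
  have h2 := hget b hb
  rw [abs_sub_comm] at h2
  have := abs_sub_le (g a) (cesaro T f N y0) (g b)
  linarith

theorem aux_int_cesaro {X : Type*} [MetricSpace X] [CompactSpace X]
    [MeasurableSpace X] [BorelSpace X] (T : X ≃ₜ X) (ν : ProbabilityMeasure X)
    (hν : IsInvariantMeasure T ν) (f : C(X, ℝ)) (n : ℕ) (hn : n ≠ 0) :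
    ∫ y, cesaro T f n y ∂ν.toMeasure = ∫ y, f y ∂ν.toMeasure := by
  have hmp : MeasurePreserving T ν.toMeasure ν.toMeasure := ⟨T.continuous.measurable, hν⟩
  unfold cesaro
  rw [integral_const_mul, integral_finsetSum]
  · have : ∀ i ∈ Finset.range n, ∫ y, f ((⇑T)^[i] y) ∂ν.toMeasure = ∫ y, f y ∂ν.toMeasure := by
      intro i _
      have h := (hmp.iterate i).map_eq
      conv_rhs => rw [← h]
      rw [integral_map (hmp.iterate i).aemeasurable f.continuous.aestronglyMeasurable]
    rw [Finset.sum_congr rfl this]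
    simp
    field_simp
  · intro i _
    exact aux_integrable ν.toMeasure (f.comp ⟨_, T.continuous.iterate i⟩)

theorem aux_int_eq {X : Type*} [MetricSpace X] [CompactSpace X]
    [MeasurableSpace X] [BorelSpace X] (T : X ≃ₜ X) (ν : ProbabilityMeasure X)
    (hν : IsInvariantMeasure T ν) {K : Set X} (hc : IsClosed K) (hνK : ν.toMeasure K = 1)
    (f : C(X, ℝ)) (c : ℝ)
    (h : ∀ y ∈ K, Tendsto (fun n => cesaro T f n y) atTop (𝓝 c)) :
    ∫ y, f y ∂ν.toMeasure = c := by
  rw [← prob_compl_eq_zero_iff hc.measurableSet] at hνK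
  have hae : ∀ᵐ y ∂ν.toMeasure, y ∈ K := hνK
  have h1 : Tendsto (fun n => ∫ y, cesaro T f n y ∂ν.toMeasure) atTop
      (𝓝 (∫ _, c ∂ν.toMeasure)) := by
    refine tendsto_integral_of_dominated_convergence (fun _ => ‖f‖)
      (fun n => (aux_cont T f n).aestronglyMeasurable) (integrable_const _) ?_ ?_
    · intro n
      refine Eventually.of_forall fun y => ?_
      unfold cesaro
      rw [norm_mul, norm_inv, Real.norm_natCast]
      have : ‖∑ i ∈ Finset.range n, f ((⇑T)^[i] y)‖ ≤ n * ‖f‖ := by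
        refine (norm_sum_le_of_le _ (fun i _ => f.norm_coe_le_norm _)).trans ?_
        simp
      rcases eq_or_ne n 0 with rfl | hn
      · simp
      rw [inv_mul_le_iff₀ (by positivity)]
      exact this
    · filter_upwards [hae] with y hy using h y hy
  have h2 : Tendsto (fun n => ∫ y, cesaro T f n y ∂ν.toMeasure) atTop
      (𝓝 (∫ y, f y ∂ν.toMeasure)) := by
    refine tendsto_const_nhds.congr' ?_
    filter_upwards [eventually_ne_atTop 0] with n hn
    exact (aux_int_cesaro T ν hν f n hn).symm
  simpa using tendsto_nhds_unique h2 h1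

/-- `(X,T)` is strictly partitionable iff it is pointwise ergodic and
semi-simple. -/
theorem stmt_4 {X : Type*} [MetricSpace X] [CompactSpace X]
    [MeasurableSpace X] [BorelSpace X] (T : X ≃ₜ X) :
    StrictlyPartitionable T ↔ PointwiseErgodic T ∧ SemiSimple T := by
  constructor
  · intro h
    refine ⟨fun x => ?_, fun x => ?_⟩
    · obtain ⟨K, hx, hK, μ, ⟨hμ, hμK⟩, hu⟩ := h x
      exact ⟨μ, aux_ergodic T μ hμ hμK hK.2.1 hu, aux_generic T x μ hK.2.1 hK.2.2.1 hx hu⟩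
    · obtain ⟨K, hx, hK, -⟩ := h x
      exact ⟨K, hK, hx⟩
  · rintro ⟨hp, hs⟩ x
    obtain ⟨K, hK, hx⟩ := hs x
    choose Φ hΦe hΦ using hp
    refine ⟨K, hx, hK, Φ x, ⟨(hΦe x).map_eq, aux_supp T x _ atTop (hΦ x) hK.2.1 hK.2.2.1 hx⟩, ?_⟩
    rintro ν ⟨hν, hνK⟩
    refine Subtype.ext (aux_ext ν.toMeasure (Φ x).toMeasure fun f => ?_)
    refine aux_int_eq T ν hν hK.2.1 hνK f _ fun y hy => ?_
    have := aux_const T hK f (fun y => ∫ z, f z ∂(Φ y).toMeasure) (fun y => hΦ y f) hy hx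
    have h2 := hΦ y f
    rw [this] at h2
    exact h2
end

section
/- A topological dynamical system (X,T) is continuously pointwise ergodic if and only if it is partitionable and the generic-point partition 𝒫 is upper semicontinuous. -/
open MeasureTheory Filter Topology Metric

section Aux

variable {X : Type*} [MetricSpace X] [CompactSpace X]
  [MeasurableSpace X] [BorelSpace X]

lemma aux_integrable_s5 (μ : ProbabilityMeasure X) (f : C(X, ℝ)) :
    Integrable (fun y => f y) μ.toMeasure :=
  (BoundedContinuousFunction.mkOfCompact f).integrable μ.toMeasure

lemma aux_ext_s5 {μ ν : ProbabilityMeasure X}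
    (h : ∀ f : C(X, ℝ), ∫ y, f y ∂μ.toMeasure = ∫ y, f y ∂ν.toMeasure) : μ = ν := by
  apply Subtype.ext
  have i1 : IsFiniteMeasure (μ : Measure X) := inferInstance
  have i2 : IsFiniteMeasure (ν : Measure X) := inferInstance
  refine @ext_of_forall_integral_eq_of_IsFiniteMeasure X _ _ _ _ _ _ i1 i2 ?_
  intro f
  exact h f.toContinuousMap

lemma aux_tendsto {ι : Type*} {F : Filter ι} {μs : ι → ProbabilityMeasure X}
    {μ : ProbabilityMeasure X} :
    Tendsto μs F (𝓝 μ) ↔ ∀ f : C(X, ℝ),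
      Tendsto (fun i => ∫ y, f y ∂(μs i).toMeasure) F (𝓝 (∫ y, f y ∂μ.toMeasure)) := by
  rw [ProbabilityMeasure.tendsto_iff_forall_integral_tendsto]
  constructor
  · intro h f
    exact h (BoundedContinuousFunction.mkOfCompact f)
  · intro h f
    exact h f.toContinuousMap

lemma aux_inv_s5 {T : X ≃ₜ X} {μ : ProbabilityMeasure X} :
    IsInvariantMeasure T μ ↔
      ∀ f : C(X, ℝ), ∫ y, f (T y) ∂μ.toMeasure = ∫ y, f y ∂μ.toMeasure := by
  have key : ∀ f : C(X, ℝ), ∫ y, f y ∂(μ.toMeasure.map T) = ∫ y, f (T y) ∂μ.toMeasure := by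
    intro f
    exact integral_map T.continuous.measurable.aemeasurable
      f.continuous.aestronglyMeasurable
  constructor
  · intro h f
    rw [← key f, h]
  · intro h
    have : IsProbabilityMeasure (μ.toMeasure.map T) :=
      Measure.isProbabilityMeasure_map T.continuous.measurable.aemeasurable
    have := aux_ext_s5 (μ := ⟨μ.toMeasure.map T, this⟩) (ν := μ) (by
      intro f
      exact (key f).trans (h f))
    exact congrArg Subtype.val this

noncomputable def distFun (S : Set X) : C(X, ℝ) := ⟨fun y => infDist y S, continuous_infDist_pt S⟩

lemma aux_supp_s5 {μ : ProbabilityMeasure X} {S : Set X} (hS : IsClosed S) (hne : S.Nonempty)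
    (h : ∫ y, distFun S y ∂μ.toMeasure = 0) : μ.toMeasure S = 1 := by
  rw [integral_eq_zero_iff_of_nonneg (f := fun y => distFun S y)
    (fun y => infDist_nonneg (x := y) (s := S)) (aux_integrable_s5 μ _)] at h
  rw [← mem_ae_iff_prob_eq_one hS.measurableSet]
  filter_upwards [h] with y hy
  exact (hS.mem_iff_infDist_zero hne).2 hy

lemma aux_ae {μ : ProbabilityMeasure X} {S : Set X} (hS : IsClosed S)
    (h : μ.toMeasure S = 1) : ∀ᵐ y ∂μ.toMeasure, y ∈ S :=
  (mem_ae_iff_prob_eq_one hS.measurableSet).2 h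

lemma cesaro_eq (T : X ≃ₜ X) (f : X → ℝ) (n : ℕ) (x : X) :
    cesaro T f n x = birkhoffAverage ℝ T f n x := rfl

lemma cesaro_diff (T : X ≃ₜ X) (f : C(X, ℝ)) (x : X) :
    Tendsto (fun n => cesaro T f n (T x) - cesaro T f n x) atTop (𝓝 0) := by
  have hb : Bornology.IsBounded (Set.range f) := (isCompact_range f.continuous).isBounded
  exact tendsto_birkhoffAverage_apply_sub_birkhoffAverage' ℝ hb T x

lemma cesaro_shift (T : X ≃ₜ X) (f : C(X, ℝ)) (n : ℕ) (x : X) :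
    cesaro T (fun y => f (T y)) n x = cesaro T f n (T x) := by
  unfold cesaro
  congr 1
  apply Finset.sum_congr rfl
  intro i _
  rw [← Function.iterate_succ_apply, Function.iterate_succ_apply']

lemma generic_shift {T : X ≃ₜ X} {x : X} {μ : ProbabilityMeasure X} :
    IsGenericFor T (T x) μ ↔ IsGenericFor T x μ := by
  refine forall_congr' fun f => ?_
  have h := cesaro_diff T f x
  constructor
  · intro h1
    simpa using h1.sub h
  · intro h1
    simpa using h.add h1

lemma generic_unique {T : X ≃ₜ X} {x : X} {μ ν : ProbabilityMeasure X}
    (h : IsGenericFor T x μ) (h' : IsGenericFor T x ν) : μ = ν :=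
  aux_ext_s5 fun f => tendsto_nhds_unique (h f) (h' f)

lemma iterate_mem {T : X ≃ₜ X} {K : Set X} (hK : IsInvariantSet T K) {x : X} (hx : x ∈ K)
    (i : ℕ) : (⇑T)^[i] x ∈ K := by
  induction i with
  | zero => exact hx
  | succ n ih =>
    rw [Function.iterate_succ_apply', ← hK]
    exact ⟨_, ih, rfl⟩

lemma cesaro_dist {T : X ≃ₜ X} {K : Set X} (hK : IsInvariantSet T K) {x : X} (hx : x ∈ K)
    (n : ℕ) : cesaro T (distFun K) n x = 0 := by
  unfold cesaro
  rw [Finset.sum_eq_zero, mul_zero]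
  intro i _
  exact infDist_zero_of_mem (iterate_mem hK hx i)

lemma generic_supp {T : X ≃ₜ X} {K : Set X} (hc : IsClosed K) (hK : IsInvariantSet T K)
    {x : X} (hx : x ∈ K) {μ : ProbabilityMeasure X} (h : IsGenericFor T x μ) :
    μ.toMeasure K = 1 := by
  apply aux_supp_s5 hc ⟨x, hx⟩
  have := h (distFun K)
  simp only [cesaro_dist hK hx] at this
  exact tendsto_nhds_unique this tendsto_const_nhds

/-- empirical measures -/
noncomputable def empM (T : X ≃ₜ X) (x : X) (n : ℕ) : Measure X :=
  ((n + 1 : ℕ) : ENNReal)⁻¹ • ∑ i ∈ Finset.range (n + 1), Measure.dirac ((⇑T)^[i] x)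

instance empM_prob (T : X ≃ₜ X) (x : X) (n : ℕ) : IsProbabilityMeasure (empM T x n) := by
  constructor
  simp only [empM, Measure.smul_apply, Measure.finsetSum_apply, measure_univ]
  simp only [Finset.sum_const, Finset.card_range, nsmul_eq_mul, mul_one, smul_eq_mul]
  exact ENNReal.inv_mul_cancel (by simp) (by simp)

noncomputable def emp (T : X ≃ₜ X) (x : X) (n : ℕ) : ProbabilityMeasure X := ⟨empM T x n, inferInstance⟩

lemma integral_emp (T : X ≃ₜ X) (x : X) (n : ℕ) (f : C(X, ℝ)) :
    ∫ y, f y ∂(emp T x n).toMeasure = cesaro T f (n + 1) x := by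
  change ∫ y, f y ∂(empM T x n) = _
  unfold empM cesaro
  rw [integral_smul_measure, integral_finsetSum_measure]
  · simp only [integral_dirac, ENNReal.toReal_inv, ENNReal.toReal_natCast, smul_eq_mul]
  · intro i _
    exact (BoundedContinuousFunction.mkOfCompact f).integrable _

lemma aux_clusterPt {α ι : Type*} [TopologicalSpace α] [CompactSpace α] {F : Filter ι}
    {u : ι → α} {a : α}
    (h : ∀ U : Ultrafilter ι, ↑U ≤ F → ∀ b, Tendsto u U (𝓝 b) → b = a) : Tendsto u F (𝓝 a) := by
  rw [tendsto_iff_ultrafilter]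
  intro U hU
  have hb' : Tendsto u U (𝓝 (U.map u).lim) := (U.map u).le_nhds_lim
  generalize (U.map u).lim = b at hb'
  rwa [h U hU b hb'] at hb'

lemma generic_of_ue {T : X ≃ₜ X} {K : Set X} (hc : IsClosed K) (hK : IsInvariantSet T K)
    {x : X} (hx : x ∈ K) {μ : ProbabilityMeasure X}
    (hu : ∀ ν : ProbabilityMeasure X, IsInvariantMeasure T ν → ν.toMeasure K = 1 → ν = μ) :
    IsGenericFor T x μ := by
  have key : Tendsto (emp T x) atTop (𝓝 μ) := by
    apply aux_clusterPt
    intro U hU ν hν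
    rw [aux_tendsto] at hν
    simp only [integral_emp] at hν
    have hs : Tendsto (fun n : ℕ => n + 1) (U : Filter ℕ) atTop :=
      (tendsto_add_atTop_nat 1).mono_left hU
    apply hu
    · rw [aux_inv_s5]
      intro f
      have h1 := hν f
      have h2 := hν (f.comp ⟨T, T.continuous⟩)
      have h3 := (cesaro_diff T f x).comp hs
      have h4 := h1.add h3
      rw [add_zero] at h4
      refine tendsto_nhds_unique h2 (h4.congr fun n => ?_)
      have := cesaro_shift T f (n + 1) x
      simp only [Function.comp]
      rw [add_sub_cancel, ← this]
      rfl
    · apply aux_supp_s5 hc ⟨x, hx⟩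
      have := hν (distFun K)
      simp only [cesaro_dist hK hx] at this
      exact tendsto_nhds_unique this tendsto_const_nhds
  intro f
  have := aux_tendsto.1 key f
  simp only [integral_emp] at this
  exact (tendsto_add_atTop_iff_nat 1).1 this

lemma ergodic_of_ue {T : X ≃ₜ X} {K : Set X} (hc : IsClosed K)
    {μ : ProbabilityMeasure X} (hi : IsInvariantMeasure T μ) (h1 : μ.toMeasure K = 1)
    (hu : ∀ ν : ProbabilityMeasure X, IsInvariantMeasure T ν → ν.toMeasure K = 1 → ν = μ) :
    IsErgodicMeasure T μ := by
  refine ⟨⟨T.continuous.measurable, hi⟩, ⟨?_⟩⟩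
  intro s hs hTs
  by_cases h0 : μ.toMeasure s = 0
  · rw [eventuallyConst_set']
    left
    exact ae_eq_empty.2 h0
  have hp : IsProbabilityMeasure (ProbabilityTheory.cond μ.toMeasure s) :=
    ProbabilityTheory.cond_isProbabilityMeasure h0
  have heq := hu ⟨ProbabilityTheory.cond μ.toMeasure s, hp⟩ (by
    change (ProbabilityTheory.cond μ.toMeasure s).map T = ProbabilityTheory.cond μ.toMeasure s
    ext t ht
    rw [Measure.map_apply T.continuous.measurable ht, ProbabilityTheory.cond_apply hs,
      ProbabilityTheory.cond_apply hs]
    congr 1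
    conv_lhs => rw [← hTs]
    rw [← Set.preimage_inter, ← Measure.map_apply T.continuous.measurable (hs.inter ht), hi]) (by
    change ProbabilityTheory.cond μ.toMeasure s K = 1
    rw [← mem_ae_iff_prob_eq_one hc.measurableSet]
    exact ProbabilityTheory.cond_absolutelyContinuous.ae_le (aux_ae hc h1)
    )
  have h2 : μ.toMeasure s = 1 := by
    rw [← heq]
    change ProbabilityTheory.cond μ.toMeasure s s = 1
    exact ProbabilityTheory.cond_apply_self h0 (measure_ne_top _ _)
  rw [eventuallyConst_set']
  right
  exact eventuallyEq_univ.2 ((mem_ae_iff_prob_eq_one hs).2 h2)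

lemma haus_ne_top {A S : Set X} (hA : A.Nonempty) (hS : S.Nonempty) : hausdorffEDist A S ≠ ⊤ :=
  hausdorffEDist_ne_top_of_nonempty_of_bounded hA hS
    (isBounded_of_compactSpace) (isBounded_of_compactSpace)

lemma haus_seq {A : ℕ → Set X} (hA : ∀ n, (A n).Nonempty) {S : Set X} (hS : S.Nonempty)
    (h : Tendsto (fun n => hausdorffDist (A n) S) atTop (𝓝 0)) {s : X} (hs : s ∈ S) :
    ∃ a : ℕ → X, (∀ n, a n ∈ A n) ∧ Tendsto a atTop (𝓝 s) := by
  have h1 : ∀ n, ∃ a ∈ A n, dist a s < hausdorffDist (A n) S + 1 / ((n : ℝ) + 1) := by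
    intro n
    exact exists_dist_lt_of_hausdorffDist_lt' hs (lt_add_of_pos_right _ (by positivity))
      (haus_ne_top (hA n) hS)
  choose a ha hd using h1
  refine ⟨a, ha, ?_⟩
  rw [tendsto_iff_dist_tendsto_zero]
  have := h.add (tendsto_one_div_add_atTop_nhds_zero_nat (𝕜 := ℝ))
  rw [add_zero] at this
  exact squeeze_zero (fun _ => dist_nonneg) (fun n => (hd n).le) this

lemma ue_unique {T : X ≃ₜ X} {K : Set X} (hc : IsClosed K) {μ ν : ProbabilityMeasure X}
    (hg : ∀ x ∈ K, IsGenericFor T x μ) (hi : IsInvariantMeasure T ν)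
    (h1 : ν.toMeasure K = 1) : ν = μ := by
  apply aux_ext_s5
  intro f
  have hmp : MeasurePreserving T ν.toMeasure ν.toMeasure := ⟨T.continuous.measurable, hi⟩
  have hces : ∀ n : ℕ, ∫ y, cesaro T f (n + 1) y ∂ν.toMeasure = ∫ y, f y ∂ν.toMeasure := by
    intro n
    unfold cesaro
    rw [integral_const_mul, integral_finsetSum]
    · have : ∀ i ∈ Finset.range (n + 1), ∫ y, f ((⇑T)^[i] y) ∂ν.toMeasure
          = ∫ y, f y ∂ν.toMeasure := by
        intro i _
        have hi := hmp.iterate i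
        conv_rhs => rw [← hi.map_eq]
        exact (integral_map hi.measurable.aemeasurable
          f.continuous.aestronglyMeasurable).symm
      rw [Finset.sum_congr rfl this]
      simp only [Finset.sum_const, Finset.card_range, nsmul_eq_mul]
      field_simp
    · intro i _
      exact aux_integrable_s5 ν (f.comp ⟨_, T.continuous.iterate i⟩)
  have hcont : ∀ n : ℕ, Continuous (fun y => cesaro T f (n + 1) y) := by
    intro n
    unfold cesaro
    exact continuous_const.mul (continuous_finsetSum _ fun i _ =>
      f.continuous.comp (T.continuous.iterate i))
  have hlim : Tendsto (fun n : ℕ => ∫ y, cesaro T f (n + 1) y ∂ν.toMeasure) atTop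
      (𝓝 (∫ _, (∫ z, f z ∂μ.toMeasure) ∂ν.toMeasure)) := by
    apply tendsto_integral_of_dominated_convergence (fun _ => ‖f‖)
    · intro n
      exact (hcont n).aestronglyMeasurable
    · exact integrable_const _
    · intro n
      refine Eventually.of_forall fun y => ?_
      unfold cesaro
      rw [norm_mul, norm_inv, Real.norm_natCast]
      have : ‖∑ i ∈ Finset.range (n + 1), f ((⇑T)^[i] y)‖ ≤ ((n + 1 : ℕ) : ℝ) * ‖f‖ := by
        refine (norm_sum_le_of_le _ fun i _ => f.norm_coe_le_norm _).trans ?_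
        simp
      rw [inv_mul_le_iff₀ (by positivity)]
      exact this
    · filter_upwards [aux_ae hc h1] with y hy
      exact (hg y hy f).comp (tendsto_add_atTop_nat 1)
  simp only [hces, integral_const, probReal_univ, one_smul] at hlim
  exact tendsto_nhds_unique tendsto_const_nhds hlim

lemma forward (T : X ≃ₜ X) (h : ContinuouslyPointwiseErgodic T) :
    Partitionable T ∧ PartitionUSC (genericPartition T) := by
  obtain ⟨Φ, hΦ, hg⟩ := h
  have hfib : ∀ x μ, IsGenericFor T x μ ↔ Φ x = μ := fun x μ =>
    ⟨fun h => generic_unique (hg x).2 h, fun h => h ▸ (hg x).2⟩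
  constructor
  · refine ⟨Set.range fun x => Φ ⁻¹' {Φ x}, ⟨?_, ?_⟩, ?_⟩
    · rintro _ ⟨x, rfl⟩
      exact ⟨x, rfl⟩
    · intro x
      refine ⟨Φ ⁻¹' {Φ x}, ⟨⟨x, rfl⟩, rfl⟩, ?_⟩
      rintro _ ⟨⟨y, rfl⟩, hy⟩
      have : Φ x = Φ y := hy
      simp only [this]
    · rintro _ ⟨x, rfl⟩
      have hc : IsClosed (Φ ⁻¹' {Φ x}) := isClosed_singleton.preimage hΦ
      have hT : ∀ y, Φ (T y) = Φ y := fun y =>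
        (hfib _ _).1 (generic_shift.2 (hg y).2)
      have hK : IsInvariantSet T (Φ ⁻¹' {Φ x}) := by
        ext y
        constructor
        · rintro ⟨z, hz, rfl⟩
          exact (hT z).trans hz
        · intro hy
          refine ⟨T.symm y, ?_, T.apply_symm_apply y⟩
          have := hT (T.symm y)
          rw [T.apply_symm_apply] at this
          exact this.symm.trans hy
      refine ⟨hc, hK, Φ x, ⟨(hg x).1.toMeasurePreserving.map_eq,
        generic_supp hc hK (x := x) rfl (hg x).2⟩, ?_⟩
      rintro ν ⟨hi, h1⟩
      exact ue_unique hc (fun y hy => (hfib _ _).2 hy) hi h1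
  · intro A hA S hS hSc hlim
    choose μ hμe hμn hμ using hA
    obtain ⟨s₀, hs₀⟩ := hS
    have hconv : ∀ s ∈ S, Tendsto μ atTop (𝓝 (Φ s)) := by
      intro s hs
      obtain ⟨a, ha, hlim⟩ := haus_seq (fun n => (hμ n) ▸ hμn n) ⟨s₀, hs₀⟩ hlim hs
      refine ((hΦ.tendsto s).comp hlim).congr fun n => ?_
      have := ha n
      rw [hμ n] at this
      exact (hfib _ _).1 this
    refine ⟨genericFiber T (Φ s₀), ⟨Φ s₀, (hg s₀).1, ⟨s₀, (hg s₀).2⟩, rfl⟩, ?_⟩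
    intro s hs
    exact (hfib _ _).2 (tendsto_nhds_unique (hconv s hs) (hconv s₀ hs₀))

lemma backward (T : X ≃ₜ X) (hP : Partitionable T) (hU : PartitionUSC (genericPartition T)) :
    ContinuouslyPointwiseErgodic T := by
  obtain ⟨P, ⟨hne, hpart⟩, hP⟩ := hP
  choose K hK hKu using fun x => (hpart x)
  have hKP : ∀ x, K x ∈ P := fun x => (hK x).1
  have hxK : ∀ x, x ∈ K x := fun x => (hK x).2
  have hc : ∀ x, IsClosed (K x) := fun x => (hP _ (hKP x)).1
  have hinv : ∀ x, IsInvariantSet T (K x) := fun x => (hP _ (hKP x)).2.1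
  choose Φ hΦ hΦu using fun x => (hP _ (hKP x)).2.2
  have hi : ∀ x, IsInvariantMeasure T (Φ x) := fun x => (hΦ x).1
  have h1 : ∀ x, (Φ x).toMeasure (K x) = 1 := fun x => (hΦ x).2
  have hu : ∀ x, ∀ ν : ProbabilityMeasure X, IsInvariantMeasure T ν →
    ν.toMeasure (K x) = 1 → ν = Φ x := fun x ν a b => hΦu x ν ⟨a, b⟩
  have hgen : ∀ x, ∀ y ∈ K x, IsGenericFor T y (Φ x) := fun x y hy =>
    generic_of_ue (hc x) (hinv x) hy (hu x)
  have herg : ∀ x, IsErgodicMeasure T (Φ x) := fun x => ergodic_of_ue (hc x) (hi x) (h1 x) (hu x)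
  have hfib : ∀ x, genericFiber T (Φ x) = K x := by
    intro x
    ext y
    refine ⟨fun hy => ?_, hgen x y⟩
    have heq : Φ x = Φ y := generic_unique hy (hgen y y (hxK y))
    have ha := aux_ae (hc x) (h1 x)
    have hb := aux_ae (hc y) (h1 y)
    rw [← heq] at hb
    obtain ⟨z, hzx, hzy⟩ := (ha.and hb).exists
    have e1 := hKu z (K x) ⟨hKP x, hzx⟩
    have e2 := hKu z (K y) ⟨hKP y, hzy⟩
    rw [e1, ← e2]
    exact hxK y
  have hatom : ∀ x, K x ∈ genericPartition T := fun x =>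
    ⟨Φ x, herg x, ⟨x, hgen x x (hxK x)⟩, (hfib x).symm⟩
  refine ⟨Φ, ?_, fun x => ⟨herg x, hgen x x (hxK x)⟩⟩
  rw [continuous_iff_seqContinuous]
  intro u x hux
  apply tendsto_of_subseq_tendsto
  intro ns hns
  let C : ℕ → TopologicalSpace.NonemptyCompacts X := fun n =>
    ⟨⟨K (u (ns n)), (hc _).isCompact⟩, ⟨_, hxK _⟩⟩
  obtain ⟨S, -, φ, hφ, hlim⟩ := isCompact_univ.tendsto_subseq (x := C) (fun n => Set.mem_univ _)
  refine ⟨φ, ?_⟩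
  have hd : Tendsto (fun n => hausdorffDist (K (u (ns (φ n)))) (S : Set X)) atTop (𝓝 0) := by
    rw [tendsto_iff_edist_tendsto_0] at hlim
    have := (ENNReal.tendsto_toReal ENNReal.zero_ne_top).comp hlim
    exact this
  have hux' : Tendsto (fun n => u (ns (φ n))) atTop (𝓝 x) :=
    hux.comp (hns.comp hφ.tendsto_atTop)
  have hSc : IsClosed (S : Set X) := S.isCompact.isClosed
  have hle : ∀ n, ∀ y ∈ K (u (ns (φ n))),
      infDist y (S : Set X) ≤ hausdorffDist (K (u (ns (φ n)))) (S : Set X) := fun n y hy =>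
    infDist_le_hausdorffDist_of_mem hy (haus_ne_top ⟨y, hy⟩ S.nonempty)
  have hxS : x ∈ (S : Set X) := by
    rw [hSc.mem_iff_infDist_zero S.nonempty]
    have a1 := ((continuous_infDist_pt (S : Set X)).tendsto x).comp hux'
    exact tendsto_nhds_unique a1
      (squeeze_zero (fun _ => infDist_nonneg) (fun n => hle n _ (hxK _)) hd)
  obtain ⟨B, ⟨μ, hμe, hμn, rfl⟩, hSB⟩ := hU _ (fun n => hatom (u (ns (φ n)))) S S.nonempty
    S.isCompact hd
  have hμ : μ = Φ x := generic_unique (hSB hxS) (hgen x x (hxK x))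
  rw [hμ, hfib] at hSB
  apply aux_clusterPt
  intro U hU ν hν
  rw [aux_tendsto] at hν
  apply hu
  · rw [aux_inv_s5]
    intro f
    refine tendsto_nhds_unique (hν (f.comp ⟨T, T.continuous⟩)) ((hν f).congr fun n => ?_)
    exact (aux_inv_s5.1 (hi _) f).symm
  · have hS1 : ν.toMeasure (S : Set X) = 1 := by
      apply aux_supp_s5 hSc S.nonempty
      refine tendsto_nhds_unique (hν (distFun S)) ?_
      refine squeeze_zero (fun n => integral_nonneg fun y => infDist_nonneg) (fun n => ?_)
        (hd.mono_left hU)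
      have : ∫ y, distFun (S : Set X) y ∂(Φ (u (ns (φ n)))).toMeasure ≤
          ∫ _, hausdorffDist (K (u (ns (φ n)))) (S : Set X) ∂(Φ (u (ns (φ n)))).toMeasure := by
        apply integral_mono_ae (aux_integrable_s5 _ _) (integrable_const _)
        filter_upwards [aux_ae (hc _) (h1 (u (ns (φ n))))] with y hy
        exact hle n y hy
      simpa using this
    exact le_antisymm prob_le_one (hS1 ▸ measure_mono hSB)

end Aux

/-- `(X,T)` is continuously pointwise ergodic iff it is partitionable and
the generic-point partition `𝒫` is upper semicontinuous. -/
theorem stmt_5 {X : Type*} [MetricSpace X] [CompactSpace X]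
    [MeasurableSpace X] [BorelSpace X] (T : X ≃ₜ X) :
    ContinuouslyPointwiseErgodic T ↔
      Partitionable T ∧ PartitionUSC (genericPartition T) := by
  exact ⟨forward T, fun h => backward T h.1 h.2⟩
end

section
/- If a topological dynamical system (X,T) is continuously pointwise ergodic, then the set ℳ_T^e(X) of ergodic T-invariant Borel probability measures is compact in the weak-star topology. -/
open MeasureTheory Filter Topology Metric

theorem abs_cesaro_le {X : Type*} [MetricSpace X] [CompactSpace X]
    (T : X → X) (f : C(X, ℝ)) (n : ℕ) (x : X) : ‖cesaro T f n x‖ ≤ ‖f‖ := by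
  unfold cesaro
  rcases Nat.eq_zero_or_pos n with rfl | hn
  · simp
  · have hn' : (0 : ℝ) < n := by exact_mod_cast hn
    rw [norm_mul, norm_inv, Real.norm_natCast, inv_mul_le_iff₀ hn']
    calc ‖∑ i ∈ Finset.range n, f (T^[i] x)‖ ≤ ∑ i ∈ Finset.range n, ‖f‖ :=
          norm_sum_le_of_le _ (fun i _ => f.norm_coe_le_norm _)
      _ = n * ‖f‖ := by simp

theorem integral_cesaro {X : Type*} [MetricSpace X] [CompactSpace X]
    [MeasurableSpace X] [BorelSpace X] (T : X ≃ₜ X) (μ : ProbabilityMeasure X)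
    (hμ : IsErgodicMeasure T μ) (f : C(X, ℝ)) (n : ℕ) (hn : 0 < n) :
    ∫ x, cesaro T f n x ∂μ.toMeasure = ∫ x, f x ∂μ.toMeasure := by
  have hmp : MeasurePreserving T μ.toMeasure μ.toMeasure := hμ.toMeasurePreserving
  have hint : ∀ i : ℕ, Integrable (fun x => f (T^[i] x)) μ.toMeasure := fun i =>
    (f.continuous.comp (T.continuous.iterate i)).integrable_of_hasCompactSupport
      (HasCompactSupport.of_compactSpace _)
  have hi : ∀ i : ℕ, ∫ x, f (T^[i] x) ∂μ.toMeasure = ∫ x, f x ∂μ.toMeasure := by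
    intro i
    have h1 := hmp.iterate i
    have h2 := integral_map (μ := μ.toMeasure) h1.measurable.aemeasurable
      (f := f) f.continuous.aestronglyMeasurable
    rw [h1.map_eq] at h2
    exact h2.symm
  have hn' : (n : ℝ) ≠ 0 := by exact_mod_cast hn.ne'
  unfold cesaro
  rw [integral_const_mul, integral_finsetSum _ (fun i _ => hint i)]
  simp only [hi, Finset.sum_const, Finset.card_range, nsmul_eq_mul]
  field_simp

theorem exists_eq_of_ergodic {X : Type*} [MetricSpace X] [CompactSpace X]
    [MeasurableSpace X] [BorelSpace X] (T : X ≃ₜ X) (Φ : X → ProbabilityMeasure X)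
    (hc : Continuous Φ) (hg : ∀ x, IsGenericFor T x (Φ x)) (μ : ProbabilityMeasure X)
    (hμ : IsErgodicMeasure T μ) : ∃ x, Φ x = μ := by
  have hcont : ∀ f : C(X, ℝ), Continuous (fun x => ∫ y, f y ∂(Φ x).toMeasure) := by
    intro f
    rw [continuous_iff_continuousAt]
    intro x
    exact ProbabilityMeasure.tendsto_iff_forall_integral_tendsto.1 (hc.tendsto x)
      (BoundedContinuousFunction.mkOfCompact f)
  have hinv : ∀ f : C(X, ℝ), ∀ x,
      ∫ y, f y ∂(Φ (T x)).toMeasure = ∫ y, f y ∂(Φ x).toMeasure := by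
    intro f x
    have h1 := (hg (T x) f).sub (hg x f)
    have hb : Bornology.IsBounded (Set.range f) := (isCompact_range f.continuous).isBounded
    have h2 : Tendsto (fun n => cesaro T f n (T x) - cesaro T f n x) atTop (𝓝 0) :=
      tendsto_birkhoffAverage_apply_sub_birkhoffAverage' ℝ hb T x
    exact sub_eq_zero.1 (tendsto_nhds_unique h1 h2)
  have hae : ∀ f : C(X, ℝ), ∀ᵐ x ∂μ.toMeasure,
      ∫ y, f y ∂(Φ x).toMeasure = ∫ y, f y ∂μ.toMeasure := by
    intro f
    obtain ⟨c, hcc⟩ := Ergodic.ae_eq_const_of_ae_eq_comp_ae (g := fun x => ∫ y, f y ∂(Φ x).toMeasure)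
      hμ (hcont f).aestronglyMeasurable (Eventually.of_forall (fun x => hinv f x))
    have h1 : Tendsto (fun n => ∫ x, cesaro T f n x ∂μ.toMeasure) atTop
        (𝓝 (∫ x, ∫ y, f y ∂(Φ x).toMeasure ∂μ.toMeasure)) := by
      refine tendsto_integral_of_dominated_convergence (fun _ => ‖f‖) ?_ (integrable_const _) ?_ ?_
      · intro n
        refine Continuous.aestronglyMeasurable ?_
        unfold cesaro
        exact continuous_const.mul (continuous_finsetSum _
          (fun i _ => f.continuous.comp (T.continuous.iterate i)))
      · exact fun n => Eventually.of_forall (fun x => abs_cesaro_le T f n x)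
      · exact Eventually.of_forall (fun x => hg x f)
    have h2 : Tendsto (fun n => ∫ x, cesaro T f n x ∂μ.toMeasure) atTop
        (𝓝 (∫ x, f x ∂μ.toMeasure)) :=
      tendsto_const_nhds.congr' ((eventually_gt_atTop 0).mono
        (fun n hn => (integral_cesaro T μ hμ f n hn).symm))
    have h3 := tendsto_nhds_unique h1 h2
    rw [integral_congr_ae hcc] at h3
    simp at h3
    filter_upwards [hcc] with x hx
    rw [hx, ← h3]
    rfl
  have hne : (μ.toMeasure.support).Nonempty :=
    Filter.nonempty_of_mem (f := ae μ.toMeasure) Measure.support_mem_ae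
  obtain ⟨x, hx⟩ := hne
  refine ⟨x, Subtype.ext ?_⟩
  change (Φ x).toMeasure = μ.toMeasure
  refine ext_of_forall_integral_eq_of_IsFiniteMeasure (fun f => ?_)
  exact Measure.support_subset_of_isClosed
    (isClosed_eq (hcont f.toContinuousMap) continuous_const) (hae f.toContinuousMap) hx

/-- if `(X,T)` is continuously pointwise ergodic then the set `ℳ_T^e(X)` of
ergodic measures is compact in the weak-star topology. -/
theorem stmt_7 {X : Type*} [MetricSpace X] [CompactSpace X]
    [MeasurableSpace X] [BorelSpace X] (T : X ≃ₜ X)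
    (h : ContinuouslyPointwiseErgodic T) :
    IsCompact (ErgodicSet T) := by
  obtain ⟨Φ, hΦc, hΦ⟩ := h
  have : ErgodicSet T = Set.range Φ := by
    ext μ
    constructor
    · intro hμ
      exact exists_eq_of_ergodic T Φ hΦc (fun x => (hΦ x).2) μ hμ
    · rintro ⟨x, rfl⟩
      exact (hΦ x).1
  rw [this]
  exact isCompact_range hΦc
end
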